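/- Let p be a prime, r ≥ 1, d = p^{2r}, and let ζ be a primitive d-th root of unity in a field C of characteristic 0. Then for every 0 ≤ n ≤ d − 1: p^r · Ω_{r,n}(ζ) = (ζ;ζ)_n · Σ_{k=0}^{p^r − 1} [k p^r choose n]_ζ, where (ζ;ζ)_n = ∏_{k=1}^{n}(1 − ζ^k) and [m choose n]_ζ is the evaluation at q = ζ of the Gaussian binomial polynomial [m choose n]_q (equal to 0 when n > m). Equivalently, with ω_{r,n} := ζ^{n(n+1)/2} (p^r/(ζ;ζ)_n) Ω_{r,n}(ζ), one has ω_{r,n} = ζ^{n(n+1)/2} Σ_{k=0}^{p^r−1} [k p^r choose n]_ζ. -/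

import Mathlib

/-- The `q`-Pochhammer symbol `(q;q)_n = ∏_{k=1}^n (1 - q^k)` in `ℤ[q]`. -/
noncomputable def qPoch (n : ℕ) : Polynomial ℤ :=
  ∏ i ∈ Finset.range n, (1 - Polynomial.X ^ (i + 1))

section

open Finset Polynomial

lemma qPoch_succ (n : ℕ) : qPoch (n + 1) = qPoch n * (1 - X ^ (n + 1)) :=
  prod_range_succ _ _

lemma qPoch_ne_zero (n : ℕ) : qPoch n ≠ 0 := by
  refine prod_ne_zero_iff.2 fun i _ h => ?_
  have := congrArg (Polynomial.eval 0) h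
  simp at this

lemma aeval_qPoch {R : Type*} [CommRing R] (z : R) (n : ℕ) :
    aeval z (qPoch n) = ∏ k ∈ range n, (1 - z ^ (k + 1)) := by
  simp [qPoch]

section GaussianBinomial

variable {B : ℕ → ℕ → Polynomial ℤ}

lemma gaussBinom_self (hB1 : ∀ n k : ℕ, k ≤ n → B n k * (qPoch k * qPoch (n - k)) = qPoch n)
    (n : ℕ) : B n n = 1 := by
  have h := hB1 n n le_rfl
  refine mul_right_cancel₀ (qPoch_ne_zero n) ?_
  simpa [qPoch] using h

lemma gaussBinom_zero_right
    (hB1 : ∀ n k : ℕ, k ≤ n → B n k * (qPoch k * qPoch (n - k)) = qPoch n)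
    (n : ℕ) : B n 0 = 1 := by
  have h := hB1 n 0 (Nat.zero_le n)
  refine mul_right_cancel₀ (qPoch_ne_zero n) ?_
  simpa [qPoch] using h

/-- The `q`-Pascal rule. -/
lemma gaussBinom_succ_succ (hB0 : ∀ n k : ℕ, n < k → B n k = 0)
    (hB1 : ∀ n k : ℕ, k ≤ n → B n k * (qPoch k * qPoch (n - k)) = qPoch n)
    {n k : ℕ} (hk : k ≤ n) :
    B (n + 1) (k + 1) = B n (k + 1) + X ^ (n - k) * B n k := by
  rcases hk.eq_or_lt with rfl | hlt
  · simp [gaussBinom_self hB1, hB0 k (k + 1) (Nat.lt_succ_self k)]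
  · obtain ⟨m, rfl⟩ := Nat.exists_eq_add_of_lt hlt
    refine mul_right_cancel₀ (mul_ne_zero (qPoch_ne_zero (k + 1)) (qPoch_ne_zero (m + 1))) ?_
    have h1 := hB1 (k + m + 1 + 1) (k + 1) (by omega)
    have h2 := hB1 (k + m + 1) (k + 1) (by omega)
    have h3 := hB1 (k + m + 1) k (by omega)
    rw [show k + m + 1 + 1 - (k + 1) = m + 1 by omega] at h1
    rw [show k + m + 1 - (k + 1) = m by omega] at h2
    rw [show k + m + 1 - k = m + 1 by omega] at h3 ⊢
    rw [h1, qPoch_succ (k + m + 1)]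
    have e2 := qPoch_succ m
    have e3 := qPoch_succ k
    linear_combination (-(1 - X ^ (m + 1))) * h2 - X ^ (m + 1) * (1 - X ^ (k + 1)) * h3
      - B (k + m + 1) (k + 1) * qPoch (k + 1) * e2
      - X ^ (m + 1) * B (k + m + 1) k * qPoch (m + 1) * e3

/-- The `q`-binomial theorem. -/
lemma sum_gaussBinom_eq_prod (hB0 : ∀ n k : ℕ, n < k → B n k = 0)
    (hB1 : ∀ n k : ℕ, k ≤ n → B n k * (qPoch k * qPoch (n - k)) = qPoch n)
    {R : Type*} [CommRing R] (z x : R) (n : ℕ) :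
    ∑ a ∈ range (n + 1), (-1) ^ a * z ^ (a.choose 2) * aeval z (B n a) * x ^ a =
      ∏ i ∈ range n, (1 - x * z ^ i) := by
  induction n with
  | zero => simp [gaussBinom_self hB1]
  | succ n ih =>
    have hext : ∑ a ∈ range (n + 2), (-1) ^ a * z ^ (a.choose 2) * aeval z (B n a) * x ^ a =
        ∏ i ∈ range n, (1 - x * z ^ i) := by
      rw [sum_range_succ, ih, hB0 n (n + 1) (Nat.lt_succ_self n)]
      simp
    rw [sum_range_succ'] at hext
    have hterm : ∀ a ∈ range (n + 1),
        (-1) ^ (a + 1) * z ^ ((a + 1).choose 2) * aeval z (B (n + 1) (a + 1)) * x ^ (a + 1) =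
        (-1) ^ (a + 1) * z ^ ((a + 1).choose 2) * aeval z (B n (a + 1)) * x ^ (a + 1) -
          x * z ^ n * ((-1) ^ a * z ^ (a.choose 2) * aeval z (B n a) * x ^ a) := by
      intro a ha
      have han : a ≤ n := Nat.lt_succ_iff.1 (mem_range.1 ha)
      have hz : z ^ a * z ^ (n - a) = z ^ n := by rw [← pow_add, Nat.add_sub_cancel' han]
      rw [gaussBinom_succ_succ hB0 hB1 han, map_add, map_mul, map_pow, aeval_X,
        Nat.choose_succ_succ' a 1, Nat.choose_one_right, ← hz]
      ring
    rw [sum_range_succ', sum_congr rfl hterm, sum_sub_distrib, ← mul_sum, ih, prod_range_succ]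
    rw [gaussBinom_zero_right hB1] at hext ⊢
    linear_combination hext

/-- The falling-product formula for `(z;z)_n [m choose n]_z`. -/
lemma prod_mul_aeval_gaussBinom (hB0 : ∀ n k : ℕ, n < k → B n k = 0)
    (hB1 : ∀ n k : ℕ, k ≤ n → B n k * (qPoch k * qPoch (n - k)) = qPoch n)
    {F : Type*} [Field F] {z : F} (hz : z ≠ 0) (m n : ℕ) :
    (∏ k ∈ range n, (1 - z ^ (k + 1))) * aeval z (B m n) =
      ∏ i ∈ range n, (1 - z ^ (1 - n : ℤ) * z ^ m * z ^ i) := by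
  rcases lt_or_ge m n with h | h
  · rw [hB0 m n h, map_zero, mul_zero, eq_comm]
    refine prod_eq_zero (i := n - 1 - m) (mem_range.2 (by omega)) ?_
    rw [← zpow_natCast z m, ← zpow_natCast z (n - 1 - m), ← zpow_add₀ hz, ← zpow_add₀ hz,
      show (1 - n : ℤ) + m + (n - 1 - m : ℕ) = 0 by omega, zpow_zero, sub_self]
  · obtain ⟨l, rfl⟩ := Nat.exists_eq_add_of_le' h
    have key : qPoch n * B (l + n) n = ∏ i ∈ range n, (1 - X ^ (l + i + 1)) := by
      refine mul_right_cancel₀ (qPoch_ne_zero l) ?_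
      have h1 := hB1 (l + n) n h
      rw [Nat.add_sub_cancel] at h1
      have h2 : qPoch (l + n) = qPoch l * ∏ i ∈ range n, (1 - X ^ (l + i + 1)) :=
        prod_range_add _ _ _
      linear_combination h1 + h2
    have := congrArg (aeval z) key
    rw [map_mul, aeval_qPoch] at this
    rw [this, map_prod]
    refine prod_congr rfl fun i _ => ?_
    rw [← zpow_natCast z (l + n), ← zpow_natCast z i, ← zpow_add₀ hz, ← zpow_add₀ hz,
      show (1 - n : ℤ) + (l + n : ℕ) + (i : ℕ) = (l + i + 1 : ℕ) by push_cast; ring, zpow_natCast]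
    simp

end GaussianBinomial

/-- Orthogonality of the powers of a primitive root of unity. -/
lemma IsPrimitiveRoot.sum_pow_pow {R : Type*} [CommRing R] [IsDomain R] {η : R} {M : ℕ}
    (hη : IsPrimitiveRoot η M) (a : ℕ) :
    ∑ k ∈ range M, (η ^ k) ^ a = if M ∣ a then (M : R) else 0 := by
  simp_rw [← pow_mul, mul_comm _ a, pow_mul]
  split_ifs with h
  · simp [(hη.pow_eq_one_iff_dvd a).2 h]
  · have h1 : η ^ a - 1 ≠ 0 := sub_ne_zero.2 fun h' => h ((hη.pow_eq_one_iff_dvd a).1 h')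
    refine (mul_eq_zero.1 ?_).resolve_right h1
    rw [geom_sum_mul, ← pow_mul, mul_comm, pow_mul, hη.pow_eq_one, one_pow, sub_self]

lemma sum_range_ite_dvd {A : Type*} [AddCommMonoid A] {M : ℕ} (hM : 0 < M) (n : ℕ) (f : ℕ → A) :
    ∑ a ∈ range (n + 1), (if M ∣ a then f a else 0) = ∑ k ∈ range (n / M + 1), f (k * M) := by
  rw [← sum_filter]
  symm
  refine sum_bij (fun k _ => k * M) ?_ ?_ ?_ fun _ _ => rfl
  · intro k hk
    simp only [mem_range, mem_filter, Nat.lt_succ_iff] at hk ⊢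
    exact ⟨(Nat.le_div_iff_mul_le hM).1 hk, Dvd.intro_left k rfl⟩
  · intro a _ b _ h
    exact Nat.eq_of_mul_eq_mul_right hM h
  · intro a ha
    simp only [mem_range, mem_filter, Nat.lt_succ_iff] at ha
    obtain ⟨ha, k, rfl⟩ := ha
    refine ⟨k, ?_, mul_comm _ _⟩
    rw [mem_range, Nat.lt_succ_iff, Nat.le_div_iff_mul_le hM, mul_comm]
    exact ha

/-- The duality obtained by filtering the `q`-binomial theorem through the `M`-th roots of
unity. -/
lemma mul_sum_gaussBinom_mul {B : ℕ → ℕ → Polynomial ℤ}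
    (hB0 : ∀ n k : ℕ, n < k → B n k = 0)
    (hB1 : ∀ n k : ℕ, k ≤ n → B n k * (qPoch k * qPoch (n - k)) = qPoch n)
    {F : Type*} [Field F] {z : F} (hz : z ≠ 0) {M : ℕ} (hM : 0 < M)
    (hη : IsPrimitiveRoot (z ^ M) M) (n : ℕ) :
    (M : F) * ∑ k ∈ range (n / M + 1), (-1) ^ (k * M) *
        z ^ (((k * M + 1).choose 2 : ℤ) - (n * (k * M : ℕ) : ℤ)) * aeval z (B n (k * M)) =
      (∏ k ∈ range n, (1 - z ^ (k + 1))) * ∑ k ∈ range M, aeval z (B (k * M) n) := by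
  set f : ℕ → F := fun a => (-1) ^ a * z ^ (((a + 1).choose 2 : ℤ) - (n * a : ℤ)) *
    aeval z (B n a) with hf
  have hprod : ∀ k ∈ range M, (∏ k ∈ range n, (1 - z ^ (k + 1))) * aeval z (B (k * M) n) =
      ∑ a ∈ range (n + 1), f a * ((z ^ M) ^ k) ^ a := by
    intro k _
    rw [prod_mul_aeval_gaussBinom hB0 hB1 hz, ← sum_gaussBinom_eq_prod hB0 hB1]
    refine sum_congr rfl fun a _ => ?_
    have he : z ^ (((a + 1).choose 2 : ℤ) - (n * a : ℤ)) =
        z ^ (a.choose 2) * (z ^ (1 - n : ℤ)) ^ a := by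
      rw [← zpow_natCast (z ^ (1 - n : ℤ)), ← zpow_mul, ← zpow_natCast z (a.choose 2),
        ← zpow_add₀ hz, Nat.choose_succ_succ' a 1, Nat.choose_one_right]
      congr 1
      push_cast
      ring
    simp only [hf]
    rw [he, mul_comm k M, pow_mul, mul_pow]
    ring
  rw [mul_sum (range M), sum_congr rfl hprod, sum_comm]
  simp_rw [← mul_sum, hη.sum_pow_pow, mul_ite, mul_zero]
  rw [sum_range_ite_dvd hM, ← sum_mul, mul_comm]

end

/-- **The dual quantity `ω_{r,n}`** (Ophir–de Shalit, Lemma 8 (i)).  For `ζ` a primitive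
`p^{2r}`-th root of unity in a characteristic-zero field `C` and `0 ≤ n ≤ d−1`,
`p^r · Ω_{r,n}(ζ) = (ζ;ζ)_n · Σ_{k=0}^{p^r−1} [k p^r choose n]_ζ`; equivalently, with
`ω_{r,n} = ζ^{n(n+1)/2} (p^r/(ζ;ζ)_n) Ω_{r,n}(ζ)`, one has
`ω_{r,n} = ζ^{n(n+1)/2} Σ_{k=0}^{p^r−1} [k p^r choose n]_ζ`.  Here
`Ω_{r,n}(ζ) = Σ_{k=0}^{⌊n/p^r⌋} (−1)^{k p^r} ζ^{(kp^r)(kp^r+1)/2 − n k p^r} [n choose kp^r]_ζ`,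
`(ζ;ζ)_n = ∏_{k=1}^n (1 − ζ^k)`, and `B` is the Gaussian binomial coefficient
`[n choose k]_q ∈ ℤ[q]`, characterized by `[n choose k]_q (q;q)_k (q;q)_{n−k} = (q;q)_n` for
`k ≤ n` and `[n choose k]_q = 0` for `k > n`. -/
theorem stmt_10 (p : ℕ) (hp : p.Prime) (r : ℕ) (hr : 1 ≤ r)
    (C : Type*) [Field C] [CharZero C] (ζ : C) (hζ : IsPrimitiveRoot ζ (p ^ (2 * r)))
    (B : ℕ → ℕ → Polynomial ℤ)
    (hB0 : ∀ n k : ℕ, n < k → B n k = 0)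
    (hB1 : ∀ n k : ℕ, k ≤ n → B n k * (qPoch k * qPoch (n - k)) = qPoch n)
    (n : ℕ) (hn : n ≤ p ^ (2 * r) - 1) :
    (p : C) ^ r *
        (∑ k ∈ Finset.range (n / p ^ r + 1),
          (-1) ^ (k * p ^ r) *
            ζ ^ (((k * p ^ r + 1).choose 2 : ℤ) - (n * k * p ^ r : ℤ)) *
            Polynomial.aeval ζ (B n (k * p ^ r)))
      = (∏ k ∈ Finset.range n, (1 - ζ ^ (k + 1))) *
          ∑ k ∈ Finset.range (p ^ r), Polynomial.aeval ζ (B (k * p ^ r) n)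
    ∧ ζ ^ (n * (n + 1) / 2) * ((p : C) ^ r / ∏ k ∈ Finset.range n, (1 - ζ ^ (k + 1))) *
        (∑ k ∈ Finset.range (n / p ^ r + 1),
          (-1) ^ (k * p ^ r) *
            ζ ^ (((k * p ^ r + 1).choose 2 : ℤ) - (n * k * p ^ r : ℤ)) *
            Polynomial.aeval ζ (B n (k * p ^ r)))
      = ζ ^ (n * (n + 1) / 2) *
          ∑ k ∈ Finset.range (p ^ r), Polynomial.aeval ζ (B (k * p ^ r) n) := by
  have hM : 0 < p ^ r := pow_pos hp.pos r
  have hd : p ^ (2 * r) = p ^ r * p ^ r := by rw [two_mul, pow_add]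
  have hd0 : 0 < p ^ (2 * r) := pow_pos hp.pos _
  have hP : ∏ k ∈ Finset.range n, (1 - ζ ^ (k + 1)) ≠ 0 := by
    refine Finset.prod_ne_zero_iff.2 fun k hk => sub_ne_zero.2 (Ne.symm ?_)
    have hk := Finset.mem_range.1 hk
    exact hζ.pow_ne_one_of_pos_of_lt k.succ_ne_zero (by omega)
  have key := mul_sum_gaussBinom_mul hB0 hB1 (hζ.ne_zero hd0.ne') hM (hζ.pow hd0 hd) n
  simp only [Nat.cast_mul, Nat.cast_pow, ← mul_assoc] at key
  refine ⟨key, ?_⟩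
  rw [mul_assoc, div_mul_eq_mul_div, key, mul_div_cancel_left₀ _ hP]
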